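/- Let k be an algebraically closed field of characteristic 0, q ∈ k^× and G ∈ ℕ with G ≥ 1. In the free algebra k⟨x_1,x_2,x_3⟩ define z_0 := x_3 and z_{t+1} := x_2·z_t − q·z_t·x_2 for t ≥ 0. Let A be the quotient of k⟨x_1,x_2,x_3⟩ by the two-sided ideal generated by: x_2x_1 − x_1x_2 + (1/2)x_1², x_1x_3 − q·x_3x_1, z_{G+1}, and z_t² for 0 ≤ t ≤ G. Then the images of the monomials x_1^{m_1}·x_2^{m_2}·z_G^{n_G}·⋯·z_1^{n_1}·z_0^{n_0}, with m_1, m_2 ∈ ℕ and n_0, …, n_G ∈ {0,1}, form a k-basis of A, and GKdim A = 2. (A is the Nichols algebra B(lstr(−1,G)) of a Jordan block, a point with label −1, weak interaction and discrete ghost G.) -/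

import Mathlib

open scoped ENNReal

/-- The Gelfand–Kirillov dimension of a `k`-algebra `A`. -/
noncomputable def GKdim (k A : Type*) [Field k] [Ring A] [Algebra k A] : ℝ≥0∞ :=
  ⨆ (V : Submodule k A) (_ : FiniteDimensional k V),
    Filter.limsup
      (fun n : ℕ =>
        ENNReal.ofReal
          (Real.log ((Module.finrank k (↥(∑ j ∈ Finset.range (n + 1), V ^ j)) : ℕ) : ℝ) /
            Real.log (n : ℝ)))
      Filter.atTop

/-- The generator `x_{i+1}` of the free algebra `k⟨x₁,x₂,x₃⟩`. -/
noncomputable def X (k : Type*) [Field k] (i : Fin 3) : FreeAlgebra k (Fin 3) :=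
  FreeAlgebra.ι k i

/-- `z₀ := x₃`, `z_{t+1} := x₂ z_t − q z_t x₂`. -/
noncomputable def z (k : Type*) [Field k] (q : k) : ℕ → FreeAlgebra k (Fin 3)
  | 0 => X k 2
  | (t + 1) => X k 1 * z k q t - q • (z k q t * X k 1)

/-- The defining relations of `B(lstr(-1,G))`. -/
def lstrRel (k : Type*) [Field k] (q : k) (G : ℕ)
    (a b : FreeAlgebra k (Fin 3)) : Prop :=
  b = 0 ∧
    (a = X k 1 * X k 0 - X k 0 * X k 1 + ((2 : k)⁻¹) • (X k 0 * X k 0) ∨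
     a = X k 0 * X k 2 - q • (X k 2 * X k 0) ∨
     a = z k q (G + 1) ∨
     ∃ t ≤ G, a = z k q t * z k q t)

/-- The PBW monomials `x₁^{m₁} x₂^{m₂} z_G^{n_G} ⋯ z₁^{n₁} z₀^{n₀}` (`n_t ∈ {0,1}`). -/
noncomputable def bas (k : Type*) [Field k] (q : k) (G : ℕ)
    (p : ℕ × ℕ × (Fin (G + 1) → Fin 2)) : RingQuot (lstrRel k q G) :=
  RingQuot.mkAlgHom k (lstrRel k q G)
    (X k 0 ^ p.1 * X k 1 ^ p.2.1 *
      ((List.ofFn fun t : Fin (G + 1) => z k q (t : ℕ) ^ ((p.2.2 t : ℕ))).reverse).prod)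

/-- Elements `x, y, w 0, w 1, …` satisfying the defining relations of `B(lstr(-1,G))`. -/
structure IsLstr {k A : Type*} [Field k] [Ring A] [Algebra k A] (q : k) (G : ℕ)
    (x y : A) (w : ℕ → A) : Prop where
  y_mul_x : y * x = x * y - (2⁻¹ : k) • (x * x)
  x_mul_w_zero : x * w 0 = q • (w 0 * x)
  w_succ : ∀ t, w (t + 1) = y * w t - q • (w t * y)
  w_top : w (G + 1) = 0
  w_sq : ∀ t ≤ G, w t * w t = 0

/-- The ordered product `w_{N-1}^{f_{N-1}} ⋯ w_0^{f_0}`. -/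
def wordProd {A : Type*} [Monoid A] (w : ℕ → A) (N : ℕ) (f : Fin N → Fin 2) : A :=
  ((List.ofFn fun t : Fin N => w (t : ℕ) ^ ((f t : ℕ))).reverse).prod

theorem wordProd_zero {A : Type*} [Monoid A] (w : ℕ → A) (f : Fin 0 → Fin 2) :
    wordProd w 0 f = 1 := by
  simp [wordProd]

theorem wordProd_succ {A : Type*} [Monoid A] (w : ℕ → A) (N : ℕ) (f : Fin (N + 1) → Fin 2) :
    wordProd w (N + 1) f =
      w N ^ ((f (Fin.last N) : ℕ)) * wordProd w N (fun t => f t.castSucc) := by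
  simp only [wordProd, List.ofFn_succ_last]
  simp

theorem map_wordProd {A B F : Type*} [Monoid A] [Monoid B] [FunLike F A B] [MonoidHomClass F A B]
    (φ : F) (w : ℕ → A) (N : ℕ) (f : Fin N → Fin 2) :
    φ (wordProd w N f) = wordProd (fun t => φ (w t)) N f := by
  induction N with
  | zero => simp [wordProd_zero]
  | succ N ih => simp [wordProd_succ, ih]

namespace IsLstr

variable {k A : Type*} [Field k] [Ring A] [Algebra k A] {q : k} {G : ℕ} {x y : A} {w : ℕ → A}

theorem x_mul_w [CharZero k] (h : IsLstr q G x y w) (t : ℕ) : x * w t = q • (w t * x) := by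
  induction t with
  | zero => exact h.x_mul_w_zero
  | succ t ih =>
    have ih' : ∀ r, x * (w t * r) = q • (w t * (x * r)) := fun r => by
      rw [← mul_assoc, ih, smul_mul_assoc, mul_assoc]
    have hxy : x * y = y * x + (2⁻¹ : k) • (x * x) := by rw [h.y_mul_x]; abel
    have hxy' : ∀ r, x * (y * r) = y * (x * r) + (2⁻¹ : k) • (x * (x * r)) := fun r => by
      rw [← mul_assoc, hxy, add_mul, smul_mul_assoc, mul_assoc, mul_assoc]
    rw [h.w_succ]
    simp only [mul_sub, sub_mul, mul_smul_comm, smul_mul_assoc, mul_assoc, ih', hxy', ih, hxy,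
      mul_add, smul_add, smul_sub]
    module

theorem y_mul_w (h : IsLstr q G x y w) (t : ℕ) : y * w t = q • (w t * y) + w (t + 1) := by
  rw [h.w_succ]; abel

theorem w_eq_zero (h : IsLstr q G x y w) (t : ℕ) (ht : G < t) : w t = 0 := by
  induction t, ht using Nat.le_induction with
  | base => exact h.w_top
  | succ t _ ih => rw [h.w_succ, ih]; simp

theorem w_mul_self (h : IsLstr q G x y w) (t : ℕ) : w t * w t = 0 := by
  rcases le_or_gt t G with ht | ht
  · exact h.w_sq t ht
  · rw [h.w_eq_zero t ht, zero_mul]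

theorem w_anticomm_succ (h : IsLstr q G x y w) {s t : ℕ} {c : k}
    (hst : w s * w t + c • (w t * w s) = 0) :
    (w (s + 1) * w t + (c * q) • (w t * w (s + 1))) +
      (q • (w s * w (t + 1)) + c • (w (t + 1) * w s)) = 0 := by
  have e1 : y * (w s * w t + c • (w t * w s)) =
      (q * q) • ((w s * w t + c • (w t * w s)) * y) +
      ((w (s + 1) * w t + (c * q) • (w t * w (s + 1))) +
      (q • (w s * w (t + 1)) + c • (w (t + 1) * w s))) := by
    have hy : ∀ t r, y * (w t * r) = q • (w t * (y * r)) + w (t + 1) * r := fun t r => by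
      rw [← mul_assoc, h.y_mul_w, add_mul, smul_mul_assoc, mul_assoc]
    simp only [mul_add, add_mul, mul_smul_comm, smul_mul_assoc, mul_assoc, hy, h.y_mul_w, smul_add]
    module
  rw [hst] at e1
  simpa using e1.symm

theorem w_anticomm (h : IsLstr q G x y w) (d t : ℕ) :
    w (t + d) * w t + q ^ d • (w t * w (t + d)) = 0 := by
  induction d using Nat.strong_induction_on generalizing t with
  | _ d ih =>
    match d with
    | 0 => simp [h.w_mul_self]
    | 1 =>
      have := h.w_anticomm_succ (s := t) (t := t) (c := 0) (by simp [h.w_mul_self])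
      simpa using this
    | d + 2 =>
      have h1 := h.w_anticomm_succ (ih (d + 1) (by omega) t)
      have h2 := ih d (by omega) (t + 1)
      have e : q • (w (t + (d + 1)) * w (t + 1)) +
          q ^ (d + 1) • (w (t + 1) * w (t + (d + 1))) = 0 := by
        have := congrArg (q • ·) h2
        rw [show t + 1 + d = t + (d + 1) by omega] at this
        simpa [smul_smul, pow_succ, mul_comm] using this
      rw [e, add_zero] at h1
      rw [pow_succ]
      exact h1

theorem y_mul_x_pow [CharZero k] (h : IsLstr q G x y w) (a : ℕ) :
    y * x ^ a = x ^ a * y - ((a : k) * 2⁻¹) • x ^ (a + 1) := by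
  induction a with
  | zero => simp
  | succ a ih =>
    rw [pow_succ, ← mul_assoc, ih, sub_mul, mul_assoc, h.y_mul_x]
    simp only [mul_sub, mul_smul_comm, smul_mul_assoc, pow_succ, mul_assoc]
    push_cast
    module

theorem w_mul_x_pow [CharZero k] (h : IsLstr q G x y w) (hq : q ≠ 0) (t a : ℕ) :
    w t * x ^ a = (q⁻¹) ^ a • (x ^ a * w t) := by
  induction a with
  | zero => simp
  | succ a ih =>
    have e : w t * x = q⁻¹ • (x * w t) := by rw [h.x_mul_w, smul_smul, inv_mul_cancel₀ hq, one_smul]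
    rw [pow_succ, ← mul_assoc, ih, smul_mul_assoc, mul_assoc, e, mul_smul_comm, smul_smul,
      ← pow_succ, mul_assoc]

/-- The span of the ordered products of the `w t`. -/
def wordSpan (k : Type*) {A : Type*} [Field k] [Ring A] [Algebra k A] (w : ℕ → A) (N : ℕ) :
    Submodule k A :=
  Submodule.span k (Set.range (wordProd w N))

theorem wordSpan_le_succ (w : ℕ → A) (N : ℕ) : wordSpan k w N ≤ wordSpan k w (N + 1) := by
  refine Submodule.span_le.2 ?_
  rintro _ ⟨f, rfl⟩
  refine Submodule.subset_span ⟨Fin.snoc (α := fun _ => Fin 2) f 0, ?_⟩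
  simp [wordProd_succ]

theorem last_mul_mem_wordSpan (w : ℕ → A) (N : ℕ) {a : A} (ha : a ∈ wordSpan k w N) :
    w N * a ∈ wordSpan k w (N + 1) := by
  have : wordSpan k w N ≤ (wordSpan k w (N + 1)).comap (LinearMap.mulLeft k (w N)) := by
    refine Submodule.span_le.2 ?_
    rintro _ ⟨f, rfl⟩
    refine Submodule.subset_span ⟨Fin.snoc (α := fun _ => Fin 2) f 1, ?_⟩
    simp [wordProd_succ]
  exact this ha

theorem w_mul_mem_wordSpan (h : IsLstr q G x y w) (hq : q ≠ 0) (N t : ℕ) (ht : t < N) {a : A}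
    (ha : a ∈ wordSpan k w N) : w t * a ∈ wordSpan k w N := by
  induction N generalizing t a with
  | zero => omega
  | succ N ih =>
    have : wordSpan k w (N + 1) ≤ (wordSpan k w (N + 1)).comap (LinearMap.mulLeft k (w t)) := by
      refine Submodule.span_le.2 ?_
      rintro _ ⟨f, rfl⟩
      have hm : wordProd w N (fun t => f t.castSucc) ∈ wordSpan k w N :=
        Submodule.subset_span ⟨_, rfl⟩
      simp only [Submodule.comap_coe, Set.mem_preimage, LinearMap.mulLeft_apply, SetLike.mem_coe,
        wordProd_succ]
      generalize wordProd w N (fun t => f t.castSucc) = m at hm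
      have hf : (f (Fin.last N) : ℕ) = 0 ∨ (f (Fin.last N) : ℕ) = 1 := by omega
      rcases hf with hf | hf <;> rw [hf]
      · rw [pow_zero, one_mul]
        rcases Nat.lt_succ_iff_lt_or_eq.1 ht with ht' | rfl
        · exact wordSpan_le_succ w N (ih t ht' hm)
        · exact last_mul_mem_wordSpan w t hm
      · rw [pow_one, ← mul_assoc]
        rcases Nat.lt_succ_iff_lt_or_eq.1 ht with ht' | rfl
        · have e := h.w_anticomm (N - t) t
          rw [show t + (N - t) = N by omega] at e
          have e2 : w t * w N = -((q ^ (N - t))⁻¹ • (w N * w t)) := by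
            rw [eq_neg_of_add_eq_zero_left e, smul_neg, neg_neg, smul_smul,
              inv_mul_cancel₀ (pow_ne_zero _ hq), one_smul]
          rw [e2, neg_mul, smul_mul_assoc, mul_assoc]
          exact Submodule.neg_mem _ (Submodule.smul_mem _ _
            (last_mul_mem_wordSpan w N (ih t ht' hm)))
        · rw [h.w_mul_self, zero_mul]
          exact Submodule.zero_mem _
    exact this ha

theorem w_mul_mem_wordSpan_top (h : IsLstr q G x y w) (hq : q ≠ 0) (t : ℕ) {a : A}
    (ha : a ∈ wordSpan k w (G + 1)) : w t * a ∈ wordSpan k w (G + 1) := by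
  rcases lt_or_ge t (G + 1) with ht | ht
  · exact h.w_mul_mem_wordSpan hq _ t ht ha
  · rw [h.w_eq_zero t ht, zero_mul]
    exact Submodule.zero_mem _

/-- The span of the monomials `x ^ a * y ^ b * κ` with `a ≤ m`, `b ≤ n`. -/
def boxSpan (k : Type*) {A : Type*} [Field k] [Ring A] [Algebra k A] (G : ℕ)
    (x y : A) (w : ℕ → A) (m n : ℕ) : Submodule k A :=
  Submodule.span k (Set.range fun p : Fin (m + 1) × Fin (n + 1) × (Fin (G + 1) → Fin 2) =>
    x ^ (p.1 : ℕ) * y ^ (p.2.1 : ℕ) * wordProd w (G + 1) p.2.2)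

theorem mem_boxSpan {m n a b : ℕ} (ha : a ≤ m) (hb : b ≤ n) {c : A}
    (hc : c ∈ wordSpan k w (G + 1)) : x ^ a * y ^ b * c ∈ boxSpan k G x y w m n := by
  have : wordSpan k w (G + 1) ≤
      (boxSpan k G x y w m n).comap (LinearMap.mulLeft k (x ^ a * y ^ b)) := by
    refine Submodule.span_le.2 ?_
    rintro _ ⟨f, rfl⟩
    exact Submodule.subset_span ⟨(⟨a, by omega⟩, ⟨b, by omega⟩, f), rfl⟩
  exact this hc

theorem boxSpan_le {m n : ℕ} {S : Submodule k A}
    (hS : ∀ a ≤ m, ∀ b ≤ n, ∀ c ∈ wordSpan k w (G + 1), x ^ a * y ^ b * c ∈ S) :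
    boxSpan k G x y w m n ≤ S := by
  refine Submodule.span_le.2 ?_
  rintro _ ⟨⟨a, b, f⟩, rfl⟩
  exact hS a (by omega) b (by omega) _ (Submodule.subset_span ⟨f, rfl⟩)

theorem boxSpan_mono {m n m' n' : ℕ} (hm : m ≤ m') (hn : n ≤ n') :
    boxSpan k G x y w m n ≤ boxSpan k G x y w m' n' :=
  boxSpan_le fun _ ha _ hb _ hc => mem_boxSpan (ha.trans hm) (hb.trans hn) hc

theorem one_mem_boxSpan (m n : ℕ) : (1 : A) ∈ boxSpan k G x y w m n := by
  have h1 : (1 : A) ∈ wordSpan k w (G + 1) := by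
    refine Submodule.subset_span ⟨fun _ => 0, ?_⟩
    simp [wordProd]
  simpa using mem_boxSpan (k := k) (G := G) (x := x) (y := y) (w := w) (Nat.zero_le m)
    (Nat.zero_le n) h1

theorem x_pow_mul_mem_boxSpan {m n : ℕ} (d : ℕ) {a : A} (ha : a ∈ boxSpan k G x y w m n) :
    x ^ d * a ∈ boxSpan k G x y w (m + d) n := by
  have : boxSpan k G x y w m n ≤
      (boxSpan k G x y w (m + d) n).comap (LinearMap.mulLeft k (x ^ d)) := by
    refine boxSpan_le fun a ha b hb c hc => ?_
    simp only [Submodule.mem_comap, LinearMap.mulLeft_apply]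
    rw [← mul_assoc, ← mul_assoc, ← pow_add]
    exact mem_boxSpan (by omega) hb hc
  exact this ha

theorem y_mul_mem_boxSpan [CharZero k] (h : IsLstr q G x y w) {m n : ℕ} {a : A}
    (ha : a ∈ boxSpan k G x y w m n) : y * a ∈ boxSpan k G x y w (m + 1) (n + 1) := by
  have : boxSpan k G x y w m n ≤
      (boxSpan k G x y w (m + 1) (n + 1)).comap (LinearMap.mulLeft k y) := by
    refine boxSpan_le fun a ha b hb c hc => ?_
    simp only [Submodule.mem_comap, LinearMap.mulLeft_apply]
    rw [← mul_assoc, ← mul_assoc, h.y_mul_x_pow, sub_mul, mul_assoc, ← pow_succ', sub_mul,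
      smul_mul_assoc, smul_mul_assoc]
    exact Submodule.sub_mem _ (mem_boxSpan (by omega) (by omega) hc)
      (Submodule.smul_mem _ _ (mem_boxSpan (by omega) (by omega) hc))
  exact this ha

theorem y_mul_mem_boxSpan_zero {n : ℕ} {a : A}
    (ha : a ∈ boxSpan k G x y w 0 n) : y * a ∈ boxSpan k G x y w 0 (n + 1) := by
  have : boxSpan k G x y w 0 n ≤
      (boxSpan k G x y w 0 (n + 1)).comap (LinearMap.mulLeft k y) := by
    refine boxSpan_le fun a ha b hb c hc => ?_
    obtain rfl : a = 0 := by omega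
    simp only [Submodule.mem_comap, LinearMap.mulLeft_apply]
    rw [pow_zero, one_mul, ← mul_assoc, ← pow_succ', ← one_mul (y ^ (b + 1)), ← pow_zero x]
    exact mem_boxSpan le_rfl (by omega) hc
  exact this ha

theorem w_mul_y_pow_mem (h : IsLstr q G x y w) (hq : q ≠ 0) (b t : ℕ) {c : A}
    (hc : c ∈ wordSpan k w (G + 1)) : w t * (y ^ b * c) ∈ boxSpan k G x y w 0 b := by
  induction b generalizing t with
  | zero =>
    have := mem_boxSpan (x := x) (y := y) le_rfl le_rfl (h.w_mul_mem_wordSpan_top hq t hc)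
      (m := 0) (n := 0)
    simpa using this
  | succ b ih =>
    have e : w t * y = q⁻¹ • (y * w t - w (t + 1)) := by
      rw [h.y_mul_w, add_sub_cancel_right, smul_smul, inv_mul_cancel₀ hq, one_smul]
    rw [pow_succ', mul_assoc, ← mul_assoc, e, smul_mul_assoc, sub_mul, mul_assoc]
    exact Submodule.smul_mem _ _ (Submodule.sub_mem _ (y_mul_mem_boxSpan_zero (ih t))
      (boxSpan_mono le_rfl (Nat.le_succ b) (ih (t + 1))))

theorem w_mul_mem_boxSpan [CharZero k] (h : IsLstr q G x y w) (hq : q ≠ 0) (t : ℕ) {m n : ℕ} {a : A}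
    (ha : a ∈ boxSpan k G x y w m n) : w t * a ∈ boxSpan k G x y w m n := by
  have : boxSpan k G x y w m n ≤
      (boxSpan k G x y w m n).comap (LinearMap.mulLeft k (w t)) := by
    refine boxSpan_le fun a ha b hb c hc => ?_
    simp only [Submodule.mem_comap, LinearMap.mulLeft_apply]
    rw [mul_assoc, ← mul_assoc, h.w_mul_x_pow hq, smul_mul_assoc, mul_assoc]
    refine Submodule.smul_mem _ _ (boxSpan_mono (by omega) hb
      (x_pow_mul_mem_boxSpan a (h.w_mul_y_pow_mem hq b t hc)))
  exact this ha

theorem finrank_boxSpan_le (m n : ℕ) :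
    Module.finrank k (boxSpan k G x y w m n) ≤ (m + 1) * ((n + 1) * 2 ^ (G + 1)) := by
  refine (finrank_range_le_card _).trans ?_
  simp

instance (m n : ℕ) : FiniteDimensional k (boxSpan k G x y w m n) :=
  FiniteDimensional.span_of_finite k (Set.finite_range _)

end IsLstr

section GrowthBounds

open Filter Topology

variable {k A : Type*} [Field k] [Ring A] [Algebra k A]

theorem tendsto_log_const_mul_sq_div_log {C : ℝ} (hC : 0 < C) :
    Tendsto (fun n : ℕ => Real.log (C * (n : ℝ) ^ 2) / Real.log n) atTop (𝓝 2) := by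
  have hlog : Tendsto (fun n : ℕ => Real.log (n : ℝ)) atTop atTop :=
    Real.tendsto_log_atTop.comp tendsto_natCast_atTop_atTop
  have h1 : Tendsto (fun n : ℕ => Real.log C / Real.log n + 2) atTop (𝓝 (0 + 2)) :=
    (hlog.const_div_atTop _).add_const 2
  rw [zero_add] at h1
  refine h1.congr' ?_
  filter_upwards [eventually_ge_atTop 2] with n hn
  have hn' : (1 : ℝ) < n := by exact_mod_cast hn
  have := Real.log_pos hn'
  rw [Real.log_mul hC.ne' (by positivity), Real.log_pow]
  field_simp
  push_cast
  ring

/-- A discretely filtered algebra of at most quadratic growth has `GKdim` at most `2`. -/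
theorem GKdim_le_two (F : ℕ → Submodule k A) (hF : Monotone F)
    [∀ n, FiniteDimensional k (F n)] (C : ℕ)
    (hcard : ∀ n, Module.finrank k (F n) ≤ C * (n + 1) ^ 2) (h1 : (1 : A) ∈ F 0)
    (hmul : ∀ a : A, ∃ d, ∀ n, ∀ b ∈ F n, a * b ∈ F (n + d)) : GKdim k A ≤ 2 := by
  refine iSup₂_le fun V hV => ?_
  obtain ⟨d, hd⟩ : ∃ d, ∀ a ∈ V, ∀ n, ∀ b ∈ F n, a * b ∈ F (n + d) := by
    obtain ⟨s, rfl⟩ := (Submodule.fg_iff_finiteDimensional V).2 hV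
    choose e he using hmul
    refine ⟨s.sup e, fun a ha n b hb => ?_⟩
    have : Submodule.span k (s : Set A) ≤
        (F (n + s.sup e)).comap (LinearMap.mulRight k b) := by
      refine Submodule.span_le.2 fun c hc => ?_
      exact hF (Nat.add_le_add_left (Finset.le_sup (f := e) hc) n) (he c n b hb)
    exact this ha
  have hpow : ∀ j, V ^ j ≤ F (j * d) := by
    intro j
    induction j with
    | zero => simpa [Submodule.one_le] using h1
    | succ j ih =>
      rw [pow_succ', Submodule.mul_le]
      intro a ha b hb
      rw [add_mul, one_mul]
      exact hd a ha _ b (ih hb)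
  have hsum : ∀ n, ∑ j ∈ Finset.range (n + 1), V ^ j ≤ F (n * d) := by
    intro n
    refine Finset.sum_induction _ (· ≤ F (n * d)) (fun a b ha hb => sup_le ha hb) bot_le ?_
    intro j hj
    exact (hpow j).trans (hF (Nat.mul_le_mul_right d (by simpa [Nat.lt_succ_iff] using hj)))
  have hlim := (ENNReal.continuous_ofReal.tendsto _).comp (tendsto_log_const_mul_sq_div_log
    (C := (C + 1 : ℝ) * (d + 1) ^ 2) (by positivity))
  rw [show (2 : ℝ≥0∞) = ENNReal.ofReal 2 by simp, ← hlim.limsup_eq]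
  refine limsup_le_limsup ?_
  filter_upwards [eventually_ge_atTop 2] with n hn
  have hn' : (1 : ℝ) < n := by exact_mod_cast hn
  have hlogn := Real.log_pos hn'
  refine ENNReal.ofReal_le_ofReal (div_le_div_of_nonneg_right ?_ hlogn.le)
  have hle := (Submodule.finrank_mono (hsum n)).trans (hcard (n * d))
  rcases Nat.eq_zero_or_pos (Module.finrank k (↥(∑ j ∈ Finset.range (n + 1), V ^ j))) with h0 | h0
  · rw [h0, Nat.cast_zero, Real.log_zero]
    refine Real.log_nonneg ?_
    have hC : (1 : ℝ) ≤ (C + 1 : ℝ) := by linarith [(Nat.cast_nonneg C : (0 : ℝ) ≤ C)]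
    have hd' : (1 : ℝ) ≤ (d + 1 : ℝ) := by linarith [(Nat.cast_nonneg d : (0 : ℝ) ≤ d)]
    exact one_le_mul_of_one_le_of_one_le
      (one_le_mul_of_one_le_of_one_le hC (one_le_pow₀ hd')) (one_le_pow₀ hn'.le)
  · refine Real.log_le_log (by exact_mod_cast h0) ?_
    have h2 : C * (n * d + 1) ^ 2 ≤ (C + 1) * (d + 1) ^ 2 * n ^ 2 := by
      rw [mul_assoc, ← mul_pow]
      refine Nat.mul_le_mul (Nat.le_succ C) (Nat.pow_le_pow_left ?_ 2)
      nlinarith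
    exact_mod_cast hle.trans h2

/-- An algebra containing a two-parameter family of independent monomials has `GKdim` at
least `2`. -/
theorem two_le_GKdim (x y : A)
    (hxy : LinearIndependent k fun p : ℕ × ℕ => x ^ p.1 * y ^ p.2) : 2 ≤ GKdim k A := by
  set V : Submodule k A := Submodule.span k {1, x, y} with hV
  have hfin : FiniteDimensional k V := FiniteDimensional.span_of_finite k (by simp)
  refine le_trans ?_ (le_iSup₂ (f := fun (V : Submodule k A) (_ : FiniteDimensional k V) =>
    limsup (fun n : ℕ => ENNReal.ofReal
      (Real.log ((Module.finrank k (↥(∑ j ∈ Finset.range (n + 1), V ^ j)) : ℕ) : ℝ) /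
        Real.log (n : ℝ))) atTop) V hfin)
  have hmem : ∀ n a b, a + b ≤ n → x ^ a * y ^ b ∈ ∑ j ∈ Finset.range (n + 1), V ^ j := by
    intro n a b hab
    have hx : x ∈ V := Submodule.subset_span (by simp)
    have hy : y ∈ V := Submodule.subset_span (by simp)
    have h1 : x ^ a * y ^ b ∈ V ^ (a + b) := by
      rw [pow_add]
      exact Submodule.mul_mem_mul (Submodule.pow_mem_pow _ hx a) (Submodule.pow_mem_pow _ hy b)
    refine (Finset.single_le_sum (f := fun j => V ^ j) (fun _ _ => bot_le)
      (Finset.mem_range.2 (by omega : a + b < n + 1))) h1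
  have hfd : ∀ n, FiniteDimensional k ↥(∑ j ∈ Finset.range (n + 1), V ^ j) := by
    intro n
    rw [← Submodule.fg_iff_finiteDimensional]
    refine Finset.sum_induction _ Submodule.FG (fun a b ha hb => ha.sup hb) Submodule.fg_bot ?_
    intro j _
    exact ((Submodule.fg_iff_finiteDimensional V).2 hfin).pow j
  have hcard : ∀ n, (n / 2 + 1) ^ 2 ≤
      Module.finrank k ↥(∑ j ∈ Finset.range (n + 1), V ^ j) := by
    intro n
    let f : Fin (n / 2 + 1) × Fin (n / 2 + 1) → ↥(∑ j ∈ Finset.range (n + 1), V ^ j) :=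
      fun p => ⟨x ^ (p.1 : ℕ) * y ^ (p.2 : ℕ), hmem n _ _ (by omega)⟩
    have hf : LinearIndependent k f := by
      refine LinearIndependent.of_comp (Submodule.subtype _) ?_
      refine hxy.comp (fun p : Fin (n / 2 + 1) × Fin (n / 2 + 1) => ((p.1 : ℕ), (p.2 : ℕ))) ?_
      rintro ⟨a, b⟩ ⟨c, d⟩ h
      simpa [Fin.ext_iff] using h
    have := hfd n
    simpa [sq] using hf.fintype_card_le_finrank
  have hlim := (ENNReal.continuous_ofReal.tendsto _).comp (tendsto_log_const_mul_sq_div_log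
    (C := 4⁻¹) (by positivity))
  rw [show (2 : ℝ≥0∞) = ENNReal.ofReal 2 by simp, ← hlim.limsup_eq]
  refine limsup_le_limsup ?_
  filter_upwards [eventually_ge_atTop 2] with n hn
  have hn' : (1 : ℝ) < n := by exact_mod_cast hn
  refine ENNReal.ofReal_le_ofReal (div_le_div_of_nonneg_right ?_ (Real.log_pos hn').le)
  refine Real.log_le_log (by positivity) ?_
  have h1 : n ^ 2 ≤ 4 * (n / 2 + 1) ^ 2 := by
    have : n ≤ 2 * (n / 2 + 1) := by omega
    nlinarith
  have h2 : (n : ℝ) ^ 2 ≤ 4 * (Module.finrank k ↥(∑ j ∈ Finset.range (n + 1), V ^ j) : ℝ) := by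
    exact_mod_cast h1.trans (Nat.mul_le_mul_left 4 (hcard n))
  linarith

end GrowthBounds

section Presentation

open IsLstr

variable {k : Type*} [Field k] {q : k} {G : ℕ}

theorem isLstr_mkAlgHom :
    IsLstr q G (RingQuot.mkAlgHom k (lstrRel k q G) (X k 0))
      (RingQuot.mkAlgHom k (lstrRel k q G) (X k 1))
      (fun t => RingQuot.mkAlgHom k (lstrRel k q G) (z k q t)) := by
  have key : ∀ a, lstrRel k q G a 0 → RingQuot.mkAlgHom k (lstrRel k q G) a = 0 := fun a ha => by
    rw [RingQuot.mkAlgHom_rel k ha, map_zero]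
  refine ⟨?_, ?_, fun t => ?_, ?_, fun t ht => ?_⟩
  · have := key _ ⟨rfl, Or.inl rfl⟩
    simp only [map_add, map_sub, map_mul, map_smul] at this
    rw [← sub_eq_zero, ← this]
    abel
  · have := key _ ⟨rfl, Or.inr (Or.inl rfl)⟩
    simp only [map_sub, map_mul, map_smul] at this
    exact sub_eq_zero.1 this
  · simp only [z, map_sub, map_mul, map_smul]
  · exact key _ ⟨rfl, Or.inr (Or.inr (Or.inl rfl))⟩
  · have := key _ ⟨rfl, Or.inr (Or.inr (Or.inr ⟨t, ht, rfl⟩))⟩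
    simpa only [map_mul] using this

theorem bas_eq (p : ℕ × ℕ × (Fin (G + 1) → Fin 2)) :
    bas k q G p = RingQuot.mkAlgHom k (lstrRel k q G) (X k 0) ^ p.1 *
      RingQuot.mkAlgHom k (lstrRel k q G) (X k 1) ^ p.2.1 *
      wordProd (fun t => RingQuot.mkAlgHom k (lstrRel k q G) (z k q t)) (G + 1) p.2.2 := by
  rw [← map_wordProd, ← map_pow, ← map_pow, ← map_mul, ← map_mul]
  rfl

/-- The filtration of `B(lstr(-1,G))` by the exponents of `x₁` and `x₂`. -/
noncomputable def lstrFiltration (k : Type*) [Field k] (q : k) (G n : ℕ) :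
    Submodule k (RingQuot (lstrRel k q G)) :=
  boxSpan k G (RingQuot.mkAlgHom k (lstrRel k q G) (X k 0))
      (RingQuot.mkAlgHom k (lstrRel k q G) (X k 1))
      (fun t => RingQuot.mkAlgHom k (lstrRel k q G) (z k q t)) n n

theorem lstrFiltration_mono : Monotone (lstrFiltration k q G) :=
  fun _ _ h => boxSpan_mono h h

instance (n : ℕ) : FiniteDimensional k (lstrFiltration k q G n) := by
  unfold lstrFiltration; infer_instance

theorem exists_mul_mem_lstrFiltration [CharZero k] (hq : q ≠ 0) (a : RingQuot (lstrRel k q G)) :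
    ∃ d, ∀ n, ∀ b ∈ lstrFiltration k q G n, a * b ∈ lstrFiltration k q G (n + d) := by
  obtain ⟨a, rfl⟩ := RingQuot.mkAlgHom_surjective k (lstrRel k q G) a
  have h := isLstr_mkAlgHom (k := k) (q := q) (G := G)
  induction a using FreeAlgebra.induction with
  | grade0 r =>
    refine ⟨0, fun n b hb => ?_⟩
    rw [AlgHom.commutes, Algebra.algebraMap_eq_smul_one, smul_mul_assoc, one_mul]
    exact Submodule.smul_mem _ _ hb
  | grade1 i =>
    refine ⟨1, fun n b hb => ?_⟩
    match i with
    | 0 =>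
      have := boxSpan_mono le_rfl (Nat.le_succ n) (x_pow_mul_mem_boxSpan 1 hb)
      rw [pow_one] at this
      exact this
    | 1 => exact h.y_mul_mem_boxSpan hb
    | 2 => exact lstrFiltration_mono (Nat.le_succ n) (h.w_mul_mem_boxSpan hq 0 hb)
  | mul a b iha ihb =>
    obtain ⟨d, hd⟩ := iha
    obtain ⟨e, he⟩ := ihb
    refine ⟨e + d, fun n c hc => ?_⟩
    rw [map_mul, mul_assoc, ← add_assoc]
    exact hd _ _ (he n c hc)
  | add a b iha ihb =>
    obtain ⟨d, hd⟩ := iha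
    obtain ⟨e, he⟩ := ihb
    refine ⟨d + e, fun n c hc => ?_⟩
    rw [map_add, add_mul]
    exact Submodule.add_mem _ (lstrFiltration_mono (by omega) (hd n c hc))
      (lstrFiltration_mono (by omega) (he n c hc))

theorem lstrFiltration_le_span (n : ℕ) :
    lstrFiltration k q G n ≤ Submodule.span k (Set.range (bas k q G)) := by
  refine Submodule.span_le.2 ?_
  rintro _ ⟨⟨a, b, f⟩, rfl⟩
  exact Submodule.subset_span ⟨(a, b, f), bas_eq _⟩

theorem span_bas [CharZero k] (hq : q ≠ 0) :
    Submodule.span k (Set.range (bas k q G)) = ⊤ := by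
  refine eq_top_iff.2 fun a _ => ?_
  obtain ⟨d, hd⟩ := exists_mul_mem_lstrFiltration hq a
  simpa using lstrFiltration_le_span _ (hd 0 1 (one_mem_boxSpan 0 0))

theorem GKdim_lstr_le [CharZero k] (hq : q ≠ 0) : GKdim k (RingQuot (lstrRel k q G)) ≤ 2 := by
  refine GKdim_le_two (lstrFiltration k q G) lstrFiltration_mono (2 ^ (G + 1)) (fun n => ?_)
    (one_mem_boxSpan 0 0) (exists_mul_mem_lstrFiltration hq)
  exact (finrank_boxSpan_le n n).trans_eq (by ring)

end Presentation

section FockModel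

open TensorProduct

variable {k : Type*} [Field k]

/-- The creation operator of the `t`-th fermion (zero if `G < t`). -/
noncomputable def create (k : Type*) [Field k] (G t : ℕ) : Module.End k (Finset ℕ →₀ k) :=
  Finsupp.linearCombination k fun S : Finset ℕ =>
    if t ≤ G ∧ t ∉ S then Finsupp.single (insert t S) ((-1 : k) ^ (S.filter (t < ·)).card) else 0

/-- The operator multiplying an `n`-fermion state by `q ^ n`. -/
noncomputable def scaleByNumber (q : k) : Module.End k (Finset ℕ →₀ k) :=
  Finsupp.linearCombination k fun S : Finset ℕ => Finsupp.single S (q ^ S.card)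

theorem create_single (G t : ℕ) (S : Finset ℕ) (c : k) :
    create k G t (Finsupp.single S c) =
      if t ≤ G ∧ t ∉ S then Finsupp.single (insert t S) (c * (-1 : k) ^ (S.filter (t < ·)).card)
      else 0 := by
  rw [create, Finsupp.linearCombination_single]
  split_ifs <;> simp

theorem scaleByNumber_single (q : k) (S : Finset ℕ) (c : k) :
    scaleByNumber q (Finsupp.single S c) = Finsupp.single S (c * q ^ S.card) := by
  simp [scaleByNumber, Finsupp.linearCombination_single]

theorem create_eq_zero {G t : ℕ} (h : G < t) : create k G t = 0 := by
  ext S : 2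
  simp [create_single, not_le.2 h]

theorem create_mul_self (G t : ℕ) : create k G t * create k G t = 0 := by
  refine Finsupp.lhom_ext fun S c => ?_
  rw [Module.End.mul_apply, create_single]
  split_ifs
  · rw [create_single, if_neg (by simp), LinearMap.zero_apply]
  · simp

theorem create_anticomm_of_lt (G : ℕ) {s t : ℕ} (hst : s < t) :
    create k G s * create k G t + create k G t * create k G s = 0 := by
  refine Finsupp.lhom_ext fun S c => ?_
  rw [LinearMap.add_apply, Module.End.mul_apply, Module.End.mul_apply, create_single,
    create_single]
  by_cases hs : s ≤ G ∧ s ∉ S <;> by_cases ht : t ≤ G ∧ t ∉ S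
  · have h1 : ((insert t S).filter (s < ·)).card = (S.filter (s < ·)).card + 1 := by
      rw [Finset.filter_insert, if_pos hst, Finset.card_insert_of_notMem (by simp [ht.2])]
    have h2 : ((insert s S).filter (t < ·)).card = (S.filter (t < ·)).card := by
      rw [Finset.filter_insert, if_neg (by omega)]
    rw [if_pos hs, if_pos ht, create_single, create_single,
      if_pos ⟨hs.1, by simp [hs.2, hst.ne]⟩, if_pos ⟨ht.1, by simp [ht.2, hst.ne']⟩,
      Finset.insert_comm s t, ← Finsupp.single_add, h1, h2, pow_succ]
    rw [LinearMap.zero_apply, Finsupp.single_eq_zero]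
    ring
  · rw [if_pos hs, if_neg ht, map_zero, create_single, if_neg, add_zero, LinearMap.zero_apply]
    simpa [hst.ne'] using ht
  · rw [if_neg hs, if_pos ht, map_zero, create_single, if_neg, add_zero, LinearMap.zero_apply]
    simpa [hst.ne] using hs
  · rw [if_neg hs, if_neg ht]
    simp

theorem create_anticomm (G s t : ℕ) :
    create k G s * create k G t + create k G t * create k G s = 0 := by
  rcases lt_trichotomy s t with h | rfl | h
  · exact create_anticomm_of_lt G h
  · simp only [create_mul_self, add_zero]
  · exact (add_comm _ _).trans (create_anticomm_of_lt G h)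

theorem scaleByNumber_mul_create (q : k) (G t : ℕ) :
    scaleByNumber q * create k G t = q • (create k G t * scaleByNumber q) := by
  refine Finsupp.lhom_ext fun S c => ?_
  rw [LinearMap.smul_apply, Module.End.mul_apply, Module.End.mul_apply, create_single,
    scaleByNumber_single, create_single]
  split_ifs with h
  · rw [scaleByNumber_single, Finset.card_insert_of_notMem h.2, Finsupp.smul_single, smul_eq_mul]
    congr 1
    ring
  · simp

theorem scaleByNumber_pow_single (q : k) (n : ℕ) (S : Finset ℕ) (c : k) :
    (scaleByNumber q ^ n) (Finsupp.single S c) = Finsupp.single S (c * (q ^ S.card) ^ n) := by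
  induction n with
  | zero => simp
  | succ n ih =>
    rw [pow_succ', Module.End.mul_apply, ih, scaleByNumber_single, pow_succ, mul_assoc]

/-- Multiplication by a coordinate on `k[u,s]`. -/
noncomputable def mulVar (k : Type*) [Field k] (i : Fin 2) :
    Module.End k (MvPolynomial (Fin 2) k) :=
  LinearMap.mulLeft k (MvPolynomial.X i)

/-- Partial derivative on `k[u,s]`. -/
noncomputable def diffVar (k : Type*) [Field k] (i : Fin 2) :
    Module.End k (MvPolynomial (Fin 2) k) :=
  (MvPolynomial.pderiv i).toLinearMap

theorem diffVar_mul_mulVar_self (i : Fin 2) :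
    diffVar k i * mulVar k i = mulVar k i * diffVar k i + 1 := by
  ext1 m
  ext1
  simp [diffVar, mulVar]

theorem diffVar_mul_mulVar_of_ne {i j : Fin 2} (h : i ≠ j) :
    diffVar k i * mulVar k j = mulVar k j * diffVar k i := by
  refine LinearMap.ext fun f => ?_
  simp [diffVar, mulVar, MvPolynomial.pderiv_X_of_ne h.symm]

theorem mulVar_comm (i j : Fin 2) : mulVar k i * mulVar k j = mulVar k j * mulVar k i := by
  refine LinearMap.ext fun f => ?_
  simp [mulVar, mul_left_comm]

theorem diffVar_comm (i j : Fin 2) :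
    Commute (diffVar k i) (diffVar k j) := by
  have h : ⁅(MvPolynomial.pderiv i :
        Derivation k (MvPolynomial (Fin 2) k) (MvPolynomial (Fin 2) k)),
      (MvPolynomial.pderiv j :
        Derivation k (MvPolynomial (Fin 2) k) (MvPolynomial (Fin 2) k))⁆ = 0 := by
    refine MvPolynomial.derivation_ext fun l => ?_
    simp [Derivation.commutator_apply, MvPolynomial.pderiv_X, Pi.single_apply, apply_ite]
  refine LinearMap.ext fun f => ?_
  have := DFunLike.congr_fun h f
  rw [Derivation.commutator_apply, Derivation.zero_apply] at this
  exact sub_eq_zero.1 this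

/-- The action of `x₂` on `k[u,s]`. -/
noncomputable def jordanY (k : Type*) [Field k] : Module.End k (MvPolynomial (Fin 2) k) :=
  mulVar k 1 - (2⁻¹ : k) • (mulVar k 0 * mulVar k 0 * diffVar k 0)

/-- The divided powers of `-∂/∂s` on `k[u,s]`. -/
noncomputable def dividedDiff (k : Type*) [Field k] (j : ℕ) :
    Module.End k (MvPolynomial (Fin 2) k) :=
  ((-1) ^ j * (j.factorial : k)⁻¹) • diffVar k 1 ^ j

theorem jordanY_mul_mulVar :
    jordanY k * mulVar k 0 =
      mulVar k 0 * jordanY k - (2⁻¹ : k) • (mulVar k 0 * mulVar k 0) := by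
  simp only [jordanY, sub_mul, mul_sub, smul_mul_assoc, mul_smul_comm, mul_assoc,
    diffVar_mul_mulVar_self, mulVar_comm 1 0, mul_add, mul_one, smul_add]
  abel

theorem commute_mulVar_diffVar : Commute (mulVar k 0) (diffVar k 1) :=
  (diffVar_mul_mulVar_of_ne (by decide)).symm

theorem commute_mulVar_dividedDiff (j : ℕ) : Commute (mulVar k 0) (dividedDiff k j) :=
  (commute_mulVar_diffVar.pow_right j).smul_right _

theorem dividedDiff_comm (i j : ℕ) : Commute (dividedDiff k i) (dividedDiff k j) :=
  ((Commute.pow_pow_self (diffVar k 1) i j).smul_left _).smul_right _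

theorem dividedDiff_zero : dividedDiff k 0 = 1 := by
  simp [dividedDiff]

theorem diffVar_pow_mul_mulVar (j : ℕ) :
    diffVar k 1 ^ (j + 1) * mulVar k 1 =
      mulVar k 1 * diffVar k 1 ^ (j + 1) + ((j : k) + 1) • diffVar k 1 ^ j := by
  induction j with
  | zero => simp [diffVar_mul_mulVar_self]
  | succ j ih =>
    rw [pow_succ', mul_assoc, ih, mul_add, ← mul_assoc, diffVar_mul_mulVar_self, add_mul, mul_assoc,
      ← pow_succ', mul_smul_comm, ← pow_succ', one_mul]
    push_cast
    module

theorem jordanY_mul_dividedDiff_succ [CharZero k] (j : ℕ) :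
    jordanY k * dividedDiff k (j + 1) =
      dividedDiff k (j + 1) * jordanY k + dividedDiff k j := by
  have h1 : Commute (mulVar k 0 * mulVar k 0 * diffVar k 0) (diffVar k 1 ^ (j + 1)) :=
    have h0 : Commute (mulVar k 0) (diffVar k 1) := commute_mulVar_diffVar
    have hd : Commute (diffVar k 0) (diffVar k 1) := diffVar_comm 0 1
    ((h0.mul_left h0).mul_left hd).pow_right _
  have hj : ((j : k) + 1) ≠ 0 := by exact_mod_cast Nat.succ_ne_zero j
  have h2 : ((-1) ^ j * (j.factorial : k)⁻¹) =
      -((-1) ^ (j + 1) * ((j + 1).factorial : k)⁻¹ * ((j : k) + 1)) := by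
    have : (j.factorial : k) ≠ 0 := by exact_mod_cast j.factorial_ne_zero
    rw [Nat.factorial_succ]
    push_cast
    field_simp
    ring
  rw [dividedDiff, dividedDiff, h2, jordanY, mul_smul_comm, smul_mul_assoc, sub_mul, mul_sub,
    diffVar_pow_mul_mulVar, smul_mul_assoc, mul_smul_comm, h1.eq]
  module

theorem dividedDiff_succ_one (j : ℕ) : dividedDiff k (j + 1) 1 = 0 := by
  simp [dividedDiff, pow_succ, diffVar]

theorem jordanY_pow_one (b : ℕ) : (jordanY k ^ b) 1 = MvPolynomial.X 1 ^ b := by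
  induction b with
  | zero => simp
  | succ b ih =>
    rw [pow_succ', Module.End.mul_apply, ih]
    simp [jordanY, mulVar, diffVar, pow_succ']

end FockModel

/-- Operators out of which a representation of `B(lstr(-1,G))` is assembled: `u`, `v` generate the
Jordan plane, `δ j` are divided powers, `e t` are fermions and `g` is a grading operator. -/
structure IsFock {k B : Type*} [Field k] [Ring B] [Algebra k B] (q : k) (G : ℕ)
    (u v : B) (δ e : ℕ → B) (g : B) : Prop where
  v_mul_u : v * u = u * v - (2⁻¹ : k) • (u * u)
  v_mul_δ : ∀ j, v * δ (j + 1) = δ (j + 1) * v + δ j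
  δ_zero : δ 0 = 1
  δ_comm : ∀ i j, Commute (δ i) (δ j)
  u_δ : ∀ j, Commute u (δ j)
  u_e : ∀ j, Commute u (e j)
  v_e : ∀ j, Commute v (e j)
  δ_e : ∀ i j, Commute (δ i) (e j)
  u_g : Commute u g
  v_g : Commute v g
  δ_g : ∀ j, Commute (δ j) g
  e_anticomm : ∀ s t, e s * e t + e t * e s = 0
  e_eq_zero : ∀ t, G < t → e t = 0
  g_mul_e : ∀ t, g * e t = q • (e t * g)

namespace IsFock

variable {k B : Type*} [Field k] [Ring B] [Algebra k B] {q : k} {G : ℕ}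
  {u v : B} {δ e : ℕ → B} {g : B}

/-- The operator by which `z_t` acts. -/
def zOp (q : k) (G : ℕ) (δ e : ℕ → B) (g : B) (t : ℕ) : B :=
  q ^ t • ((∑ j ∈ Finset.range (G + 1), δ j * e (t + j)) * g ^ t)

theorem g_mul_sum (h : IsFock q G u v δ e g) (t : ℕ) :
    g * (∑ j ∈ Finset.range (G + 1), δ j * e (t + j)) =
      q • ((∑ j ∈ Finset.range (G + 1), δ j * e (t + j)) * g) := by
  rw [Finset.mul_sum, Finset.sum_mul, Finset.smul_sum]
  refine Finset.sum_congr rfl fun j _ => ?_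
  rw [← mul_assoc, ← (h.δ_g j).eq, mul_assoc, h.g_mul_e, mul_smul_comm, mul_assoc]

theorem g_pow_mul_sum (h : IsFock q G u v δ e g) (t n : ℕ) :
    g ^ n * (∑ j ∈ Finset.range (G + 1), δ j * e (t + j)) =
      q ^ n • ((∑ j ∈ Finset.range (G + 1), δ j * e (t + j)) * g ^ n) := by
  induction n with
  | zero => simp
  | succ n ih =>
    rw [pow_succ', mul_assoc, ih, mul_smul_comm, ← mul_assoc, h.g_mul_sum, smul_mul_assoc,
      smul_smul, mul_assoc, pow_succ]

theorem sum_mul_self [CharZero k] (h : IsFock q G u v δ e g) (t : ℕ) :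
    (∑ j ∈ Finset.range (G + 1), δ j * e (t + j)) *
      (∑ j ∈ Finset.range (G + 1), δ j * e (t + j)) = 0 := by
  have hswap : ∀ i j, (δ i * e (t + i)) * (δ j * e (t + j)) +
      (δ j * e (t + j)) * (δ i * e (t + i)) = 0 := fun i j => by
    rw [(h.δ_e j _).symm.mul_mul_mul_comm, (h.δ_e i _).symm.mul_mul_mul_comm, (h.δ_comm i j).eq,
      ← mul_add, h.e_anticomm, mul_zero]
  have h2 : (2 : k) • ((∑ j ∈ Finset.range (G + 1), δ j * e (t + j)) *
      (∑ j ∈ Finset.range (G + 1), δ j * e (t + j))) = 0 := by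
    rw [two_smul, Finset.sum_mul_sum]
    nth_rewrite 2 [Finset.sum_comm]
    simp only [← Finset.sum_add_distrib, hswap, Finset.sum_const_zero]
  exact (smul_eq_zero.1 h2).resolve_left two_ne_zero

theorem v_mul_sum (h : IsFock q G u v δ e g) (t : ℕ) :
    v * (∑ j ∈ Finset.range (G + 1), δ j * e (t + j)) =
      (∑ j ∈ Finset.range (G + 1), δ j * e (t + j)) * v +
        ∑ j ∈ Finset.range (G + 1), δ j * e (t + 1 + j) := by
  rw [Finset.sum_range_succ', Finset.sum_range_succ _ G, h.e_eq_zero (t + 1 + G) (by omega),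
    h.δ_zero]
  simp only [mul_add, add_mul, Finset.mul_sum, Finset.sum_mul, one_mul, mul_zero, add_zero,
    (h.v_e t).eq]
  rw [add_right_comm, ← Finset.sum_add_distrib]
  congr 1
  refine Finset.sum_congr rfl fun j _ => ?_
  rw [← mul_assoc, h.v_mul_δ, add_mul, mul_assoc, (h.v_e _).eq, mul_assoc,
    show t + 1 + j = t + (j + 1) by ring]

theorem isLstr [CharZero k] (h : IsFock q G u v δ e g) :
    IsLstr q G (u * g) (v * g) (zOp q G δ e g) where
  y_mul_x := by
    rw [h.u_g.symm.mul_mul_mul_comm, h.v_g.symm.mul_mul_mul_comm, h.u_g.symm.mul_mul_mul_comm,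
      h.v_mul_u, sub_mul, smul_mul_assoc]
  x_mul_w_zero := by
    have hu : Commute u (∑ j ∈ Finset.range (G + 1), δ j * e (0 + j)) :=
      Commute.sum_right _ _ _ fun j _ => (h.u_δ j).mul_right (h.u_e _)
    simp only [zOp, pow_zero, one_smul, mul_one]
    rw [mul_assoc, h.g_mul_sum, mul_smul_comm, ← mul_assoc, hu.eq, mul_assoc]
  w_succ t := by
    simp only [zOp, mul_smul_comm, smul_mul_assoc]
    rw [mul_assoc v, ← mul_assoc g, h.g_mul_sum, smul_mul_assoc, mul_assoc _ g, ← pow_succ',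
      mul_smul_comm, ← mul_assoc v, h.v_mul_sum, mul_assoc _ (g ^ t), ← mul_assoc (g ^ t) v,
      ← (h.v_g.pow_right t).eq, mul_assoc v, ← pow_succ, ← mul_assoc _ v, add_mul, pow_succ q]
    module
  w_top := by
    rw [zOp, Finset.sum_eq_zero, zero_mul, smul_zero]
    intro j _
    rw [h.e_eq_zero _ (by omega), mul_zero]
  w_sq t _ := by
    rw [zOp, smul_mul_assoc, mul_smul_comm, mul_assoc, ← mul_assoc (g ^ t), h.g_pow_mul_sum,
      smul_mul_assoc, mul_smul_comm, ← mul_assoc, ← mul_assoc, h.sum_mul_self]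
    simp

end IsFock

section Independence

open TensorProduct

variable {k : Type*} [Field k]

/-- The action of operators on `k[u,s]` on the Fock space `k[u,s] ⊗ Λ`. -/
noncomputable def actLeft (k : Type*) [Field k] : Module.End k (MvPolynomial (Fin 2) k) →ₐ[k]
    Module.End k (MvPolynomial (Fin 2) k ⊗[k] (Finset ℕ →₀ k)) :=
  Module.endTensorEndAlgHom.comp Algebra.TensorProduct.includeLeft

/-- The action of operators on `Λ` on the Fock space `k[u,s] ⊗ Λ`. -/
noncomputable def actRight (k : Type*) [Field k] : Module.End k (Finset ℕ →₀ k) →ₐ[k]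
    Module.End k (MvPolynomial (Fin 2) k ⊗[k] (Finset ℕ →₀ k)) :=
  (Module.endTensorEndAlgHom (R := k) (S := k) (A := k) (M := MvPolynomial (Fin 2) k)
    (N := Finset ℕ →₀ k)).comp Algebra.TensorProduct.includeRight

theorem actLeft_tmul (f : Module.End k (MvPolynomial (Fin 2) k)) (p : MvPolynomial (Fin 2) k)
    (m : Finset ℕ →₀ k) : actLeft k f (p ⊗ₜ m) = f p ⊗ₜ m := rfl

theorem actRight_tmul (f : Module.End k (Finset ℕ →₀ k)) (p : MvPolynomial (Fin 2) k)
    (m : Finset ℕ →₀ k) : actRight k f (p ⊗ₜ m) = p ⊗ₜ f m := rfl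

theorem commute_actLeft_actRight (f : Module.End k (MvPolynomial (Fin 2) k))
    (f' : Module.End k (Finset ℕ →₀ k)) : Commute (actLeft k f) (actRight k f') :=
  TensorProduct.ext' fun _ _ => rfl

theorem isFock_act [CharZero k] (q : k) (G : ℕ) :
    IsFock q G (actLeft k (mulVar k 0)) (actLeft k (jordanY k))
      (fun j => actLeft k (dividedDiff k j)) (fun t => actRight k (create k G t))
      (actRight k (scaleByNumber q)) where
  v_mul_u := by rw [← map_mul, jordanY_mul_mulVar, map_sub, map_smul, map_mul, map_mul]
  v_mul_δ j := by rw [← map_mul, jordanY_mul_dividedDiff_succ, map_add, map_mul]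
  δ_zero := by rw [dividedDiff_zero, map_one]
  δ_comm i j := (dividedDiff_comm i j).map (actLeft k)
  u_δ j := (commute_mulVar_dividedDiff j).map (actLeft k)
  u_e _ := commute_actLeft_actRight _ _
  v_e _ := commute_actLeft_actRight _ _
  δ_e _ _ := commute_actLeft_actRight _ _
  u_g := commute_actLeft_actRight _ _
  v_g := commute_actLeft_actRight _ _
  δ_g _ := commute_actLeft_actRight _ _
  e_anticomm s t := by rw [← map_mul, ← map_mul, ← map_add, create_anticomm, map_zero]
  e_eq_zero t ht := by rw [create_eq_zero ht, map_zero]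
  g_mul_e t := by rw [← map_mul, scaleByNumber_mul_create, map_smul, map_mul]

/-- The operator by which `z_t` acts on the Fock space `k[u,s] ⊗ Λ`. -/
noncomputable def fockZ (q : k) (G t : ℕ) :
    Module.End k (MvPolynomial (Fin 2) k ⊗[k] (Finset ℕ →₀ k)) :=
  IsFock.zOp q G (fun j => actLeft k (dividedDiff k j)) (fun t => actRight k (create k G t))
      (actRight k (scaleByNumber q)) t

theorem fockZ_tmul_single (q : k) {G t : ℕ} (ht : t ≤ G) {S : Finset ℕ} (hS : ∀ i ∈ S, i < t) :
    fockZ q G t (1 ⊗ₜ Finsupp.single S 1) =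
      (q ^ t * (q ^ S.card) ^ t) • (1 ⊗ₜ Finsupp.single (insert t S) 1) := by
  have htS : t ∉ S := fun h => lt_irrefl _ (hS t h)
  have hfil : S.filter (t < ·) = ∅ :=
    Finset.filter_eq_empty_iff.2 fun i hi => not_lt.2 (hS i hi).le
  rw [fockZ, IsFock.zOp, LinearMap.smul_apply, Module.End.mul_apply, ← map_pow, actRight_tmul,
    scaleByNumber_pow_single, LinearMap.sum_apply, Finset.sum_range_succ', Finset.sum_eq_zero]
  · rw [Module.End.mul_apply, actRight_tmul, actLeft_tmul, dividedDiff_zero, add_zero,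
      create_single, if_pos ⟨ht, htS⟩, hfil, zero_add, Module.End.one_apply,
      ← TensorProduct.tmul_smul, ← TensorProduct.tmul_smul, Finsupp.smul_single,
      Finsupp.smul_single]
    simp only [smul_eq_mul, Finset.card_empty, pow_zero, mul_one, one_mul]
  · intro j _
    rw [Module.End.mul_apply, actRight_tmul, actLeft_tmul, dividedDiff_succ_one,
      TensorProduct.zero_tmul]

/-- The set of indices at which an exponent vector is `1`. -/
def occupied {N : ℕ} (f : Fin N → Fin 2) : Finset ℕ :=
  (Finset.univ.filter fun t => f t = 1).map Fin.valEmbedding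

theorem mem_occupied {N : ℕ} (f : Fin N → Fin 2) (i : ℕ) :
    i ∈ occupied f ↔ ∃ t : Fin N, f t = 1 ∧ (t : ℕ) = i := by
  simp [occupied]

theorem lt_of_mem_occupied {N : ℕ} {f : Fin N → Fin 2} {i : ℕ} (hi : i ∈ occupied f) : i < N := by
  obtain ⟨t, _, rfl⟩ := (mem_occupied f i).1 hi
  exact t.2

theorem occupied_injective (N : ℕ) : Function.Injective (occupied (N := N)) := by
  intro f f' h
  funext t
  have key : ∀ f : Fin N → Fin 2, (t : ℕ) ∈ occupied f ↔ f t = 1 := fun f => by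
    rw [mem_occupied]
    exact ⟨fun ⟨s, hs, hst⟩ => Fin.ext hst ▸ hs, fun h => ⟨t, h, rfl⟩⟩
  have : f t = 1 ↔ f' t = 1 := by rw [← key, ← key, h]
  omega

theorem occupied_succ {N : ℕ} (f : Fin (N + 1) → Fin 2) :
    occupied f = if f (Fin.last N) = 1 then insert N (occupied fun t => f t.castSucc)
      else occupied fun t => f t.castSucc := by
  ext i
  split_ifs with h <;>
    simp [mem_occupied, Fin.exists_fin_succ', h, or_comm, eq_comm]

theorem wordProd_fockZ_vacuum {q : k} (hq : q ≠ 0) (G N : ℕ) (hN : N ≤ G + 1)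
    (f : Fin N → Fin 2) : ∃ c : kˣ, wordProd (fockZ q G) N f (1 ⊗ₜ Finsupp.single ∅ 1) =
      c • (1 ⊗ₜ Finsupp.single (occupied f) 1) := by
  induction N with
  | zero =>
    refine ⟨1, ?_⟩
    have : occupied f = ∅ := by simp [occupied]
    rw [wordProd_zero, this, one_smul, Module.End.one_apply]
  | succ N ih =>
    obtain ⟨c, hc⟩ := ih (by omega) fun t => f t.castSucc
    rw [wordProd_succ, Module.End.mul_apply, hc, occupied_succ]
    split_ifs with h
    · refine ⟨c * Units.mk0 (q ^ N * (q ^ (occupied fun t => f t.castSucc).card) ^ N)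
        (by positivity), ?_⟩
      rw [h, Fin.val_one, pow_one, Units.smul_def, map_smul,
        fockZ_tmul_single q (by omega) fun i => lt_of_mem_occupied, smul_smul]
      rfl
    · have h0 : (f (Fin.last N) : ℕ) = 0 := by omega
      exact ⟨c, by rw [h0, pow_zero, Module.End.one_apply]⟩

theorem exists_algHom_of_isLstr {B : Type*} [Ring B] [Algebra k B] {q : k} {G : ℕ} {x y : B}
    {w : ℕ → B} (h : IsLstr q G x y w) : ∃ φ : RingQuot (lstrRel k q G) →ₐ[k] B,
      φ (RingQuot.mkAlgHom k (lstrRel k q G) (X k 0)) = x ∧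
      φ (RingQuot.mkAlgHom k (lstrRel k q G) (X k 1)) = y ∧
      ∀ t, φ (RingQuot.mkAlgHom k (lstrRel k q G) (z k q t)) = w t := by
  let F : FreeAlgebra k (Fin 3) →ₐ[k] B := FreeAlgebra.lift k ![x, y, w 0]
  have h0 : F (X k 0) = x := FreeAlgebra.lift_ι_apply ..
  have h1 : F (X k 1) = y := FreeAlgebra.lift_ι_apply ..
  have h2 : F (X k 2) = w 0 := FreeAlgebra.lift_ι_apply ..
  have hz : ∀ t, F (z k q t) = w t := fun t => by
    induction t with
    | zero => exact h2
    | succ t ih => simp only [z, map_sub, map_mul, map_smul, ih, h1, h.w_succ]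
  have hF : ∀ ⦃a b⦄, lstrRel k q G a b → F a = F b := by
    rintro a _ ⟨rfl, rfl | rfl | rfl | ⟨t, ht, rfl⟩⟩
    · simp only [map_sub, map_add, map_mul, map_smul, map_zero, h0, h1, h.y_mul_x]
      abel
    · simp only [map_sub, map_mul, map_smul, map_zero, h0, h2, h.x_mul_w_zero, sub_self]
    · rw [hz, h.w_top, map_zero]
    · rw [map_mul, hz, h.w_sq t ht, map_zero]
  refine ⟨RingQuot.liftAlgHom k ⟨F, hF⟩, ?_, ?_, fun t => ?_⟩
  · rw [RingQuot.liftAlgHom_mkAlgHom_apply, h0]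
  · rw [RingQuot.liftAlgHom_mkAlgHom_apply, h1]
  · rw [RingQuot.liftAlgHom_mkAlgHom_apply, hz]

theorem jordan_pow_mul_pow_tmul (q : k) (a b : ℕ) (S : Finset ℕ) :
    ((actLeft k (mulVar k 0) * actRight k (scaleByNumber q)) ^ a *
      (actLeft k (jordanY k) * actRight k (scaleByNumber q)) ^ b) (1 ⊗ₜ Finsupp.single S 1) =
      ((q ^ S.card) ^ b * (q ^ S.card) ^ a) •
        ((MvPolynomial.X 0 ^ a * MvPolynomial.X 1 ^ b) ⊗ₜ Finsupp.single S 1) := by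
  have hX : ∀ p, (mulVar k 0 ^ a) p = MvPolynomial.X 0 ^ a * p := fun p => by
    rw [mulVar, LinearMap.pow_mulLeft, LinearMap.mulLeft_apply]
  rw [(commute_actLeft_actRight _ _).mul_pow, (commute_actLeft_actRight _ _).mul_pow]
  simp only [← map_pow, Module.End.mul_apply, actRight_tmul, actLeft_tmul,
    scaleByNumber_pow_single, jordanY_pow_one, hX]
  rw [← TensorProduct.tmul_smul, Finsupp.smul_single, one_mul, smul_eq_mul, mul_one]

theorem linearIndependent_bas [CharZero k] {q : k} (hq : q ≠ 0) (G : ℕ) :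
    LinearIndependent k (bas k q G) := by
  obtain ⟨φ, hx, hy, hw⟩ := exists_algHom_of_isLstr (isFock_act q G).isLstr
  let vac : MvPolynomial (Fin 2) k ⊗[k] (Finset ℕ →₀ k) := 1 ⊗ₜ Finsupp.single ∅ 1
  let ev := (LinearMap.applyₗ vac) ∘ₗ φ.toLinearMap
  let 𝓑 := (MvPolynomial.basisMonomials (Fin 2) k).tensorProduct
    (Finsupp.basisSingleOne (R := k) (ι := Finset ℕ))
  let idx : ℕ × ℕ × (Fin (G + 1) → Fin 2) → (Fin 2 →₀ ℕ) × Finset ℕ := fun p =>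
    (Finsupp.single 0 p.1 + Finsupp.single 1 p.2.1, occupied p.2.2)
  have hidx : Function.Injective idx := by
    rintro ⟨a, b, f⟩ ⟨a', b', f'⟩ h
    obtain ⟨h1, h2⟩ := Prod.ext_iff.1 h
    have ha := DFunLike.congr_fun h1 0
    have hb := DFunLike.congr_fun h1 1
    simp only [idx, Finsupp.add_apply] at ha hb
    simp at ha hb
    have hf : f = f' := occupied_injective _ h2
    rw [ha, hb, hf]
  have key : ∀ p, ∃ c : kˣ, ev (bas k q G p) = c • 𝓑 (idx p) := by
    rintro ⟨a, b, f⟩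
    obtain ⟨c, hc⟩ := wordProd_fockZ_vacuum hq G (G + 1) le_rfl f
    have hev : ev (bas k q G (a, b, f)) =
        ((actLeft k (mulVar k 0) * actRight k (scaleByNumber q)) ^ a *
        (actLeft k (jordanY k) * actRight k (scaleByNumber q)) ^ b)
          (wordProd (fockZ q G) (G + 1) f vac) := by
      simp only [ev, LinearMap.comp_apply, AlgHom.toLinearMap_apply, LinearMap.applyₗ_apply_apply,
        bas_eq, map_mul, map_pow, map_wordProd, hx, hy, hw]
      rfl
    have hB : 𝓑 (idx (a, b, f)) = (MvPolynomial.X 0 ^ a * MvPolynomial.X 1 ^ b) ⊗ₜ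
        Finsupp.single (occupied f) 1 := by
      simp [𝓑, idx, Module.Basis.tensorProduct_apply, MvPolynomial.X_pow_eq_monomial,
        MvPolynomial.monomial_mul]
    refine ⟨c * Units.mk0 ((q ^ (occupied f).card) ^ b * (q ^ (occupied f).card) ^ a)
      (by positivity), ?_⟩
    rw [hev, hc, Units.smul_def, map_smul, jordan_pow_mul_pow_tmul, hB, smul_smul]
    rfl
  choose c hc using key
  refine LinearIndependent.of_comp ev ?_
  have : ev ∘ bas k q G = c • (𝓑 ∘ idx) := funext hc
  rw [this]
  exact (𝓑.linearIndependent.comp idx hidx).units_smul c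

theorem two_le_GKdim_lstr [CharZero k] {q : k} (hq : q ≠ 0) (G : ℕ) :
    2 ≤ GKdim k (RingQuot (lstrRel k q G)) := by
  have hinj : Function.Injective fun p : ℕ × ℕ =>
      ((p.1, p.2, fun _ => 0) : ℕ × ℕ × (Fin (G + 1) → Fin 2)) := by
    rintro ⟨a, b⟩ ⟨a', b'⟩ h
    simpa using h
  have h := (linearIndependent_bas hq G).comp _ hinj
  have e : (bas k q G ∘ fun p : ℕ × ℕ => (p.1, p.2, fun _ => 0)) = fun p =>
      RingQuot.mkAlgHom k (lstrRel k q G) (X k 0) ^ p.1 *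
        RingQuot.mkAlgHom k (lstrRel k q G) (X k 1) ^ p.2 := by
    funext p
    simp [bas_eq, wordProd]
  rw [e] at h
  exact two_le_GKdim _ _ h

end Independence

/-- The PBW monomials form a basis of `B(lstr(-1,G))`, and
`GKdim B(lstr(-1,G)) = 2`. -/
theorem statement10 (k : Type*) [Field k] [IsAlgClosed k] [CharZero k]
    (q : k) (hq : q ≠ 0) (G : ℕ) (hG : 1 ≤ G) :
    (LinearIndependent k (bas k q G) ∧
      Submodule.span k (Set.range (bas k q G)) = ⊤) ∧
    GKdim k (RingQuot (lstrRel k q G)) = 2 := by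
  exact ⟨⟨linearIndependent_bas hq G, span_bas hq⟩,
    le_antisymm (GKdim_lstr_le hq) (two_le_GKdim_lstr hq G)⟩
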